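/- arXiv:math/9909169 — 2 statements merged into one kernel-verified Lean document; each statement's English description precedes it below -/
import Mathlib

section
/- For every n ≥ 1 and N ≥ 0, the probability that the longest weakly increasing subsequence of an inhomogeneous random word of length N has length at most n equals the sum, over all partitions λ of N with at most k parts and with first part λ₁ ≤ n, of s_λ(p₁,…,p_k)·f^λ. That is, Prob(ℓ_N ≤ n) = Σ_{λ ⊢ N, ℓ(λ) ≤ k, λ₁ ≤ n} s_λ(p₁,…,p_k) f^λ. -/
open MeasureTheory Filter
open scoped Classical

noncomputable section

/-- Length of the longest weakly increasing subsequence of the word `w`. -/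
def lisLen {k N : ℕ} (w : Fin N → Fin k) : ℕ :=
  (Finset.univ.filter fun s : Finset (Fin N) =>
    ∀ i ∈ s, ∀ j ∈ s, i ≤ j → w i ≤ w j).sup Finset.card

/-- Probability of the event `E` of words of length `N` under the i.i.d. measure
in which letter `i` has probability `p i`. -/
def wordProb (k N : ℕ) (p : Fin k → ℝ) (E : Set (Fin N → Fin k)) : ℝ :=
  ∑ w : Fin N → Fin k, E.indicator (fun w => ∏ i, p (w i)) w

/-- `T` is a semistandard Young tableau of shape `l` with entries in `{0,...,k-1}`. -/
def IsSSYT (k : ℕ) (l : Fin k → ℕ) (T : Fin k × ℕ → ℕ) : Prop :=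
  (∀ (i : Fin k) (j1 j2 : ℕ), j1 ≤ j2 → j2 < l i → T (i, j1) ≤ T (i, j2)) ∧
  (∀ (i1 i2 : Fin k) (j : ℕ), i1 < i2 → j < l i2 → T (i1, j) < T (i2, j)) ∧
  (∀ (i : Fin k) (j : ℕ), j < l i → T (i, j) < k) ∧
  (∀ (i : Fin k) (j : ℕ), l i ≤ j → T (i, j) = 0)

/-- The Schur polynomial `s_l(x)`, as the generating function of SSYT of shape `l`. -/
def schur (k : ℕ) (l : Fin k → ℕ) (x : Fin k → ℝ) : ℝ :=
  ∑ᶠ T ∈ {T | IsSSYT k l T}, ∏ v : Fin k,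
    x v ^ ({c : Fin k × ℕ | c.2 < l c.1 ∧ T c = (v : ℕ)}.ncard)

/-- `T` is a standard Young tableau of shape `l ⊢ N` (entries `0,...,N-1`, each once). -/
def IsSYT (k N : ℕ) (l : Fin k → ℕ) (T : Fin k × ℕ → ℕ) : Prop :=
  (∀ (i : Fin k) (j1 j2 : ℕ), j1 < j2 → j2 < l i → T (i, j1) < T (i, j2)) ∧
  (∀ (i1 i2 : Fin k) (j : ℕ), i1 < i2 → j < l i2 → T (i1, j) < T (i2, j)) ∧
  (∀ (i : Fin k) (j : ℕ), l i ≤ j → T (i, j) = 0) ∧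
  Set.BijOn T {c : Fin k × ℕ | c.2 < l c.1} (Set.Iio N)

/-- `f^l`: the number of standard Young tableaux of shape `l ⊢ N`. -/
def sytCount (k N : ℕ) (l : Fin k → ℕ) : ℕ := {T | IsSYT k N l T}.ncard

/-- The multinomial probability of the outcome `l` in `N` trials. -/
def multProb (k N : ℕ) (p : Fin k → ℝ) (l : Fin k → ℕ) : ℝ :=
  ((N.factorial : ℝ) / ∏ i, ((l i).factorial : ℝ)) * ∏ i, p i ^ l i

/-- The mean of `lisLen` over random words of length `N`. -/
def wordMean (k N : ℕ) (p : Fin k → ℝ) : ℝ :=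
  ∑ w : Fin N → Fin k, (∏ i, p (w i)) * (lisLen w : ℝ)

/-- The variance of `lisLen` over random words of length `N`. -/
def wordVar (k N : ℕ) (p : Fin k → ℝ) : ℝ :=
  ∑ w : Fin N → Fin k, (∏ i, p (w i)) * ((lisLen w : ℝ) - wordMean k N p) ^ 2


/-- Semistandard tableaux with entries in `{0,...,k-1}`, encoded as Gelfand-Tsetlin patterns:
`g v i` is the number of entries smaller than `v` in row `i`. -/
structure IsPattern (k : ℕ) (g : ℕ → ℕ → ℕ) : Prop where
  zero : ∀ i, g 0 i = 0
  le_succ : ∀ v i, g v i ≤ g (v + 1) i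
  succ_le : ∀ v i, g (v + 1) (i + 1) ≤ g v i
  stable : ∀ v, k ≤ v → ∀ i, g v i = g k i

/-- When the letter `a` is row-inserted, `track g a v` is `0` if the shape formed by the entries
smaller than `v` does not change, and `r + 1` if that shape gains a box in row `r`. -/
def track (g : ℕ → ℕ → ℕ) (a : ℕ) : ℕ → ℕ
  | 0 => 0
  | v + 1 =>
    if v < a then 0
    else if v = a then 1
    else if g v (track g a v - 1) < g (v + 1) (track g a v - 1) then track g a v + 1
    else track g a v

/-- Row insertion of the letter `a` into a pattern. -/
def rowInsert (g : ℕ → ℕ → ℕ) (a : ℕ) : ℕ → ℕ → ℕ :=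
  fun v i => g v i + if track g a v = i + 1 then 1 else 0

lemma track_eq_zero_iff (g : ℕ → ℕ → ℕ) (a v : ℕ) : track g a v = 0 ↔ v ≤ a := by
  induction v with
  | zero => simp [track]
  | succ v ih => rw [track]; split_ifs <;> grind

lemma track_le (g : ℕ → ℕ → ℕ) (a v : ℕ) : track g a v ≤ v := by
  induction v with
  | zero => simp [track]
  | succ v ih => rw [track]; split_ifs <;> omega

/-- Above the inserted letter, the track moves one row down exactly where it meets an entry. -/
lemma track_succ {g : ℕ → ℕ → ℕ} {a v i : ℕ} (h : track g a v = i + 1) :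
    track g a (v + 1) = if g v i < g (v + 1) i then i + 2 else i + 1 := by
  have := track_eq_zero_iff g a v
  rw [track, h]
  grind

lemma track_succ_of_eq_zero {g : ℕ → ℕ → ℕ} {a v : ℕ} (h : track g a v = 0) :
    track g a (v + 1) = if v = a then 1 else 0 := by
  have := track_eq_zero_iff g a v
  rw [track]
  grind

namespace IsPattern

variable {k : ℕ} {g h : ℕ → ℕ → ℕ}

lemma mono (hg : IsPattern k g) (i : ℕ) : Monotone fun v => g v i :=
  monotone_nat_of_le_succ fun v => hg.le_succ v i

lemma anti (hg : IsPattern k g) (v : ℕ) : Antitone (g v) :=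
  antitone_nat_of_succ_le fun i => (hg.le_succ v (i + 1)).trans (hg.succ_le v i)

lemma eq_zero (hg : IsPattern k g) {v i : ℕ} (hvi : v ≤ i) : g v i = 0 := by
  induction v generalizing i with
  | zero => exact hg.zero i
  | succ v ih =>
    obtain ⟨i, rfl⟩ : ∃ j, i = j + 1 := ⟨i - 1, by omega⟩
    have := hg.succ_le v i
    have := ih (i := i) (by omega)
    omega

lemma le_top (hg : IsPattern k g) (v i : ℕ) : g v i ≤ g k i := by
  rcases le_total v k with hv | hv
  · exact hg.mono i hv
  · exact (hg.stable v hv i).le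

lemma eq_zero_of_le (hg : IsPattern k g) {i : ℕ} (hi : k ≤ i) (v : ℕ) : g v i = 0 :=
  Nat.le_zero.1 ((hg.le_top v i).trans (hg.eq_zero hi).le)

/-- The row singled out by the track can receive a box. -/
lemma addable (hg : IsPattern k g) {a v i : ℕ} (ht : track g a v = i + 2) :
    g v (i + 1) < g v i := by
  induction v generalizing i with
  | zero => simp [track] at ht
  | succ v ih =>
    have h1 := hg.le_succ v i
    have h2 := hg.le_succ v (i + 1)
    have h3 := hg.succ_le v i
    rcases hs : track g a v with _ | j
    · have := track_succ_of_eq_zero hs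
      grind
    · have := track_succ hs
      rcases (by grind : j = i ∨ j = i + 1) with rfl | rfl
      · grind
      · have := ih hs
        grind

lemma rowInsert (hg : IsPattern k g) {a : ℕ} (ha : a < k) : IsPattern k (rowInsert g a) where
  zero i := by simp [_root_.rowInsert, hg.zero, track]
  le_succ v i := by
    have h1 := hg.le_succ v i
    unfold _root_.rowInsert
    by_cases hs : track g a v = i + 1
    · have := track_succ hs
      grind
    · grind
  succ_le v i := by
    have h1 := hg.succ_le v i
    have h2 := hg.le_succ v (i + 1)
    unfold _root_.rowInsert
    rcases hs : track g a v with _ | j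
    · have := track_succ_of_eq_zero hs
      grind
    · have := track_succ hs
      by_cases hj : j = i + 1
      · subst hj
        have := hg.addable hs
        grind
      · grind
  stable v hv i := by
    have key : track g a v = track g a k := by
      induction v, hv using Nat.le_induction with
      | base => rfl
      | succ v hv ih =>
        rcases hs : track g a v with _ | j
        · have := track_eq_zero_iff g a v
          omega
        · rw [track_succ hs, hg.stable v hv, hg.stable (v + 1) (by omega), ← ih, hs]
          simp
    simp [_root_.rowInsert, key, hg.stable v hv]

lemma sum_rowInsert (g : ℕ → ℕ → ℕ) (a : ℕ) {v : ℕ} (hv : v ≤ k) :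
    ∑ i : Fin k, _root_.rowInsert g a v i = ∑ i : Fin k, g v i + if a < v then 1 else 0 := by
  simp only [_root_.rowInsert, Finset.sum_add_distrib]
  congr 1
  have h0 := track_eq_zero_iff g a v
  have h1 := track_le g a v
  split_ifs with hav
  · rw [Finset.sum_eq_single ⟨track g a v - 1, by omega⟩]
    · rw [if_pos]; simp only; omega
    · intro b _ hb
      rw [if_neg]
      intro hb'
      apply hb
      ext
      simp only
      omega
    · simp
  · exact Finset.sum_eq_zero fun i _ => if_neg (by omega)

/-- Row insertion acts on the first row as the recursion for longest weakly increasing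
subsequences. -/
lemma rowInsert_zero (hg : IsPattern k g) (a v : ℕ) :
    _root_.rowInsert g a v 0 = if a < v then max (g v 0) (g (a + 1) 0 + 1) else g v 0 := by
  unfold _root_.rowInsert
  have key : a < v → (track g a v = 1 ∧ g v 0 = g (a + 1) 0) ∨
      (2 ≤ track g a v ∧ g (a + 1) 0 + 1 ≤ g v 0) := by
    intro hav
    induction v, hav using Nat.le_induction with
    | base => 
      have := track_succ_of_eq_zero ((track_eq_zero_iff g a a).2 le_rfl)
      grind
    | succ v hv ih =>
      have := hg.le_succ v 0
      rcases hs : track g a v with _ | j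
      · have := track_eq_zero_iff g a v
        omega
      · have := track_succ hs
        grind
  have := track_eq_zero_iff g a v
  grind

/-- The track can be recovered, from top to bottom, from the result of the insertion. -/
lemma track_eq (hg : IsPattern k g) (a v : ℕ) :
    track g a v = if 1 ≤ track g a (v + 1) ∧
        _root_.rowInsert g a v (track g a (v + 1) - 1) <
          _root_.rowInsert g a (v + 1) (track g a (v + 1) - 1)
      then track g a (v + 1) - 1 else track g a (v + 1) := by
  unfold _root_.rowInsert
  rcases hs : track g a v with _ | j
  · have := track_succ_of_eq_zero hs
    have := hg.le_succ v 0
    grind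
  · have := track_succ hs
    have := hg.le_succ v j
    have := hg.le_succ v (j + 1)
    grind

lemma rowInsert_injective {g' : ℕ → ℕ → ℕ} (hg : IsPattern k g) (hg' : IsPattern k g')
    {a a' : ℕ} (ha : a < k) (ha' : a' < k)
    (heq : _root_.rowInsert g a = _root_.rowInsert g' a')
    (ht : track g a k = track g' a' k) : g = g' ∧ a = a' := by
  have key : ∀ j, track g a (k - j) = track g' a' (k - j) := by
    intro j
    induction j with
    | zero => exact ht
    | succ j ih =>
      by_cases hj : k ≤ j
      · rwa [Nat.sub_eq_zero_of_le hj, ← Nat.sub_eq_zero_of_le (hj.trans j.le_succ)] at ih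
      · rw [hg.track_eq, hg'.track_eq, heq, show k - (j + 1) + 1 = k - j by omega, ih]
  have key' : ∀ v ≤ k, track g a v = track g' a' v := fun v hv => by
    simpa [Nat.sub_sub_self hv] using key (k - v)
  have hle : ∀ v ≤ k, ∀ i, g v i = g' v i := fun v hv i => by
    have := congrFun (congrFun heq v) i
    simpa [_root_.rowInsert, key' v hv] using this
  constructor
  · funext v i
    rcases le_total v k with hv | hv
    · exact hle v hv i
    · rw [hg.stable v hv, hg'.stable v hv, hle k le_rfl]
  · have h1 := track_eq_zero_iff g a a
    have h2 := track_eq_zero_iff g' a' a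
    have h3 := track_eq_zero_iff g a a'
    have h4 := track_eq_zero_iff g' a' a'
    have h5 := key' a ha.le
    have h6 := key' a' ha'.le
    omega

lemma exists_reverse_track (hh : IsPattern k h) (s : ℕ) :
    ∃ t : ℕ → ℕ, t k = s + 1 ∧ ∀ v, t v =
      if 1 ≤ t (v + 1) ∧ h v (t (v + 1) - 1) < h (v + 1) (t (v + 1) - 1)
      then t (v + 1) - 1 else t (v + 1) := by
  let step : ℕ → ℕ → ℕ := fun j x =>
    if 1 ≤ x ∧ h (k - (j + 1)) (x - 1) < h (k - (j + 1) + 1) (x - 1) then x - 1 else x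
  let b : ℕ → ℕ := fun j => Nat.rec (s + 1) step j
  have hb : ∀ j, b (j + 1) = step j (b j) := fun _ => rfl
  refine ⟨fun v => b (k - v), by simp [b], fun v => ?_⟩
  beta_reduce
  rcases lt_or_ge v k with hv | hv
  · obtain ⟨j, hj⟩ : ∃ j, k - v = j + 1 := ⟨k - v - 1, by omega⟩
    have h1 : k - (v + 1) = j := by omega
    have h2 : k - (j + 1) = v := by omega
    rw [hj, h1, hb]
    subst h2
    rfl
  · rw [Nat.sub_eq_zero_of_le hv, Nat.sub_eq_zero_of_le (hv.trans v.le_succ)]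
    simp [hh.stable v hv, hh.stable (v + 1) (hv.trans v.le_succ)]

/-- Every corner of the shape of a tableau can be removed by reverse row insertion. -/
lemma exists_rowInsert_eq (hh : IsPattern k h) {s : ℕ} (hs : h k (s + 1) < h k s) :
    ∃ g a, IsPattern k g ∧ a < k ∧ track g a k = s + 1 ∧ _root_.rowInsert g a = h := by
  obtain ⟨t, htk, ht⟩ := hh.exists_reverse_track s
  have htop : ∀ v, k ≤ v → t v = s + 1 := by
    intro v hv
    induction v, hv using Nat.le_induction with
    | base => exact htk
    | succ v hv ih =>
      have := ht v
      simp only [hh.stable v hv, hh.stable (v + 1) (hv.trans v.le_succ), lt_irrefl, and_false,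
        if_false] at this
      omega
  have hrem : ∀ j i, t (k - j) = i + 1 → h (k - j) (i + 1) < h (k - j) i := by
    intro j
    induction j with
    | zero =>
      intro i hi
      rw [Nat.sub_zero, htk] at hi
      obtain rfl : s = i := by omega
      exact hs
    | succ j ih =>
      intro i hi
      by_cases hj : k ≤ j
      · rw [Nat.sub_eq_zero_of_le (hj.trans j.le_succ)] at hi ⊢
        rw [Nat.sub_eq_zero_of_le hj] at ih
        exact ih i hi
      · have e : k - j = k - (j + 1) + 1 := by omega
        rw [e] at ih
        have h0 := ht (k - (j + 1))
        generalize k - (j + 1) = v at *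
        have h1 := hh.le_succ v (i + 1)
        have h2 := hh.le_succ v i
        have h3 := hh.succ_le v i
        grind
  have hrem' : ∀ v i, t v = i + 1 → h v (i + 1) < h v i := by
    intro v i hi
    rcases le_total v k with hv | hv
    · have := hrem (k - v) i
      rw [Nat.sub_sub_self hv] at this
      exact this hi
    · rw [htop v hv] at hi
      rw [hh.stable v hv, hh.stable v hv]
      obtain rfl : s = i := by omega
      exact hs
  have ht0 : t 0 = 0 := by
    by_contra h0
    obtain ⟨i, hi⟩ := Nat.exists_eq_succ_of_ne_zero h0
    have := hrem' 0 i hi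
    simp [hh.zero] at this
  have hmono : Monotone t := monotone_nat_of_le_succ fun v => by
    have := ht v
    grind
  obtain ⟨a, ha⟩ : ∃ a, ∀ v, t v = 0 ↔ v ≤ a := by
    have hex : ∃ v, t v ≠ 0 := ⟨k, by omega⟩
    have hpos : Nat.find hex ≠ 0 := fun h0 => Nat.find_spec hex (by rw [h0, ht0])
    refine ⟨Nat.find hex - 1, fun v => ⟨fun hv => ?_, fun hv => ?_⟩⟩
    · by_contra hlt
      have := hmono (show Nat.find hex ≤ v by omega)
      have := Nat.find_spec hex
      omega
    · have := Nat.find_min hex (show v < Nat.find hex by omega)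
      simpa using this
  have hak : a < k := by
    have := (ha k).not
    omega
  have hgP : IsPattern k (fun v i => h v i - if t v = i + 1 then 1 else 0) := by
    refine ⟨fun i => by simp [hh.zero], fun v i => ?_, fun v i => ?_, fun v hv i => ?_⟩
    · have := ht v
      have := hh.le_succ v i
      clear ht htop hrem hrem' ha hmono
      grind
    · have := ht v
      have := hh.succ_le v i
      have := hrem' (v + 1) i
      clear ht htop hrem hrem' ha hmono
      grind
    · simp [hh.stable v hv, htop v hv, htk]
  have htrack : ∀ v, track (fun v i => h v i - if t v = i + 1 then 1 else 0) a v = t v := by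
    intro v
    induction v with
    | zero => simp [track, ht0]
    | succ v ih =>
      have h0 := ht v
      rcases hv : t v with _ | i
      · rw [track_succ_of_eq_zero (ih.trans hv)]
        have := ha v
        have := ha (v + 1)
        clear ht htop hrem hrem' ha hmono hgP
        grind
      · rw [track_succ (ih.trans hv)]
        have := hrem' v i hv
        have := hh.le_succ v i
        clear ht htop hrem hrem' ha hmono hgP
        grind
  refine ⟨_, a, hgP, hak, (htrack k).trans htk, ?_⟩
  funext v i
  simp only [_root_.rowInsert, htrack]
  have := hrem' v i
  clear ht htop hrem hrem' ha hmono hgP htrack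
  grind

end IsPattern

/-- The insertion tableau of a word, as a pattern. -/
def insertionPattern {k : ℕ} : ∀ {N : ℕ}, (Fin N → Fin k) → ℕ → ℕ → ℕ
  | 0, _ => fun _ _ => 0
  | _ + 1, w => rowInsert (insertionPattern (Fin.init w)) (w (Fin.last _))

/-- The shape of a pattern. -/
def patternShape (k : ℕ) (g : ℕ → ℕ → ℕ) : Fin k → ℕ := fun i => g k i

/-- The monomial of a pattern. -/
def patternWeight (k : ℕ) (p : Fin k → ℝ) (g : ℕ → ℕ → ℕ) : ℝ :=
  ∏ v : Fin k, p v ^ (∑ i : Fin k, (g (v + 1) i - g v i))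

lemma isPattern_insertionPattern {k N : ℕ} (w : Fin N → Fin k) :
    IsPattern k (insertionPattern w) := by
  induction N with
  | zero => constructor <;> simp [insertionPattern]
  | succ N ih => exact (ih _).rowInsert (w (Fin.last N)).2

lemma sum_insertionPattern {k N : ℕ} (w : Fin N → Fin k) :
    ∑ i : Fin k, insertionPattern w k i = N := by
  induction N with
  | zero => simp [insertionPattern]
  | succ N ih => simp [insertionPattern, IsPattern.sum_rowInsert, ih]

lemma IsPattern.patternWeight_eq {k : ℕ} {g : ℕ → ℕ → ℕ} (hg : IsPattern k g) (p : Fin k → ℝ) :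
    patternWeight k p g =
      ∏ v : Fin k, p v ^ (∑ i : Fin k, g (v + 1) i - ∑ i : Fin k, g v i) :=
  Finset.prod_congr rfl fun v _ => by
    rw [Finset.sum_tsub_distrib (f := fun i : Fin k => g (v + 1) i) (g := fun i : Fin k => g v i)
      _ fun i _ => hg.le_succ v i]

lemma patternWeight_insertionPattern {k N : ℕ} (p : Fin k → ℝ) (w : Fin N → Fin k) :
    patternWeight k p (insertionPattern w) = ∏ i, p (w i) := by
  induction N with
  | zero => simp [patternWeight, insertionPattern]
  | succ N ih =>
    rw [Fin.prod_univ_castSucc]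
    change _ = (∏ i, p (Fin.init w i)) * _
    rw [← ih, (isPattern_insertionPattern w).patternWeight_eq,
      (isPattern_insertionPattern _).patternWeight_eq,
      ← Finset.prod_ite_eq' Finset.univ (w (Fin.last N)) p |>.trans (if_pos (Finset.mem_univ _)),
      ← Finset.prod_mul_distrib]
    refine Finset.prod_congr rfl fun v _ => ?_
    have hle : ∑ i : Fin k, insertionPattern (Fin.init w) v i ≤
        ∑ i : Fin k, insertionPattern (Fin.init w) (v + 1) i :=
      Finset.sum_le_sum fun i _ => (isPattern_insertionPattern _).le_succ v i
    simp only [insertionPattern]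
    rw [IsPattern.sum_rowInsert _ _ (v := v + 1) v.2, IsPattern.sum_rowInsert _ _ v.2.le]
    rcases lt_trichotomy v (w (Fin.last N)) with hv | hv | hv
    · rw [if_neg (by omega), if_neg (by omega), if_neg hv.ne]
      simp
    · rw [if_pos (by omega), if_neg (by omega), if_pos hv, ← pow_succ]
      congr 1
      omega
    · rw [if_pos (by omega), if_pos (by omega), if_neg hv.ne']
      rw [Nat.add_sub_add_right, mul_one]

/-- Schensted's theorem: the first row of the insertion tableau records the lengths of the longest
weakly increasing subsequences with bounded letters. -/
lemma isGreatest_insertionPattern {k N : ℕ} (w : Fin N → Fin k) (v : ℕ) :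
    IsGreatest {m | ∃ s : Finset (Fin N), (∀ i ∈ s, ∀ j ∈ s, i ≤ j → w i ≤ w j) ∧
      (∀ i ∈ s, (w i : ℕ) < v) ∧ s.card = m} (insertionPattern w v 0) := by
  induction N generalizing v with
  | zero =>
    refine ⟨⟨∅, by simp [insertionPattern]⟩, ?_⟩
    rintro m ⟨s, -, -, rfl⟩
    simp [Finset.eq_empty_of_isEmpty s]
  | succ N ih =>
    have hrec := (isPattern_insertionPattern (Fin.init w)).rowInsert_zero (w (Fin.last N)) v
    change insertionPattern w v 0 = _ at hrec
    have lift : ∀ u, ∃ s : Finset (Fin (N + 1)), (∀ i ∈ s, ∀ j ∈ s, i ≤ j → w i ≤ w j) ∧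
        (∀ i ∈ s, (w i : ℕ) < u) ∧ s.card = insertionPattern (Fin.init w) u 0 ∧
        Fin.last N ∉ s := by
      intro u
      obtain ⟨⟨s, hs, hsu, hcard⟩, -⟩ := ih (Fin.init w) u
      refine ⟨s.map Fin.castSuccEmb, ?_, ?_, by simpa using hcard, ?_⟩
      · simp only [Finset.mem_map, Fin.coe_castSuccEmb, forall_exists_index, and_imp]
        rintro _ i hi rfl _ j hj rfl hij
        exact hs i hi j hj hij
      · simp only [Finset.mem_map, Fin.coe_castSuccEmb, forall_exists_index, and_imp]
        rintro _ i hi rfl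
        exact hsu i hi
      · simp only [Finset.mem_map, Fin.coe_castSuccEmb, not_exists, not_and]
        exact fun i _ => (Fin.castSucc_lt_last i).ne
    have bound : ∀ u, ∀ s : Finset (Fin (N + 1)), (∀ i ∈ s, ∀ j ∈ s, i ≤ j → w i ≤ w j) →
        (∀ i ∈ s, (w i : ℕ) < u) →
        (s.erase (Fin.last N)).card ≤ insertionPattern (Fin.init w) u 0 := by
      intro u s hs hsu
      refine (ih (Fin.init w) u).2 ⟨Finset.univ.filter fun i => i.castSucc ∈ s, ?_, ?_, ?_⟩
      · simp only [Finset.mem_filter, Finset.mem_univ, true_and]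
        exact fun i hi j hj hij => hs _ hi _ hj (by simpa using hij)
      · simp only [Finset.mem_filter, Finset.mem_univ, true_and]
        exact fun i hi => hsu _ hi
      · rw [← Finset.card_map Fin.castSuccEmb]
        congr 1
        ext i
        induction i using Fin.lastCases with
        | last => simp [(Fin.castSucc_lt_last _).ne]
        | cast i => simp [(Fin.castSucc_lt_last i).ne]
    constructor
    · rw [hrec]
      split_ifs with hv
      · rcases le_total (insertionPattern (Fin.init w) ((w (Fin.last N) : ℕ) + 1) 0 + 1)
          (insertionPattern (Fin.init w) v 0) with hmax | hmax
        · rw [max_eq_left hmax]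
          obtain ⟨s, h1, h2, h3, -⟩ := lift v
          exact ⟨s, h1, h2, h3⟩
        · rw [max_eq_right hmax]
          obtain ⟨s, h1, h2, h3, h4⟩ := lift ((w (Fin.last N) : ℕ) + 1)
          refine ⟨insert (Fin.last N) s, ?_, ?_, by rw [Finset.card_insert_of_notMem h4, h3]⟩
          · intro i hi j hj hij
            rcases Finset.mem_insert.1 hj with rfl | hj
            · rcases Finset.mem_insert.1 hi with rfl | hi
              · rfl
              · have := h2 i hi
                omega
            · rcases Finset.mem_insert.1 hi with rfl | hi
              · exact absurd ((Fin.last_le_iff.1 hij) ▸ hj) h4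
              · exact h1 i hi j hj hij
          · intro i hi
            rcases Finset.mem_insert.1 hi with rfl | hi
            · exact hv
            · have := h2 i hi
              omega
      · obtain ⟨s, h1, h2, h3, -⟩ := lift v
        exact ⟨s, h1, h2, h3⟩
    · rintro m ⟨s, h1, h2, rfl⟩
      rw [hrec]
      by_cases hl : Fin.last N ∈ s
      · rw [if_pos (h2 _ hl)]
        have := bound ((w (Fin.last N) : ℕ) + 1) s h1
          fun i hi => Nat.lt_succ_of_le (h1 i hi _ hl (Fin.le_last i))
        rw [Finset.card_erase_of_mem hl] at this
        exact le_max_of_le_right (by omega)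
      · have := bound v s h1 h2
        rw [Finset.erase_eq_of_notMem hl] at this
        split_ifs
        · exact le_max_of_le_left this
        · exact this

lemma lisLen_eq {k N : ℕ} (w : Fin N → Fin k) : lisLen w = insertionPattern w k 0 := by
  obtain ⟨⟨s, h1, -, h3⟩, hub⟩ := isGreatest_insertionPattern w k
  apply le_antisymm
  · refine Finset.sup_le fun s hs => hub ⟨s, (Finset.mem_filter.1 hs).2, fun i _ => (w i).2, rfl⟩
  · rw [← h3]
    exact Finset.le_sup (f := Finset.card) (Finset.mem_filter.2 ⟨Finset.mem_univ _, h1⟩)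

lemma finite_fillings {k : ℕ} (l : Fin k → ℕ) (M : ℕ) :
    {T : Fin k × ℕ → ℕ | (∀ i j, j < l i → T (i, j) < M) ∧
      ∀ i j, l i ≤ j → T (i, j) = 0}.Finite := by
  refine (Set.finite_range fun (f : (Σ i, Fin (l i)) → Fin M) (c : Fin k × ℕ) =>
    if h : c.2 < l c.1 then (f ⟨c.1, c.2, h⟩ : ℕ) else 0).subset ?_
  rintro T ⟨h1, h2⟩
  refine ⟨fun c => ⟨T (c.1, c.2), h1 _ _ c.2.2⟩, ?_⟩
  funext ⟨i, j⟩
  by_cases h : j < l i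
  · simp [h]
  · simp [h, h2 i j (not_lt.1 h)]

/-- Row `s` of the diagram of `l` ends in a removable box. -/
def IsShapeCorner {k : ℕ} (l : Fin k → ℕ) (s : Fin k) : Prop := 0 < l s ∧ ∀ i, s < i → l i < l s

/-- The shape `l` without the last box of row `s`. -/
def removeBox {k : ℕ} (l : Fin k → ℕ) (s : Fin k) : Fin k → ℕ := Function.update l s (l s - 1)

lemma cells_removeBox {k : ℕ} {l : Fin k → ℕ} {s : Fin k} (i : Fin k) (j : ℕ) (hs : 0 < l s) :
    j < removeBox l s i ↔ j < l i ∧ (i, j) ≠ (s, l s - 1) := by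
  unfold removeBox
  by_cases h : i = s
  · subst h
    simp
    omega
  · simp [h]

section StandardTableaux

variable {k N : ℕ} {l : Fin k → ℕ}

lemma IsSYT.finite (k N : ℕ) (l : Fin k → ℕ) : {T | IsSYT k N l T}.Finite :=
  (finite_fillings l N).subset fun _ hT => ⟨fun _ _ hj => hT.2.2.2.mapsTo hj, hT.2.2.1⟩

lemma IsSYT.update {s : Fin k} (hl : Antitone l) (hs : IsShapeCorner l s) {T : Fin k × ℕ → ℕ}
    (hT : IsSYT k N (removeBox l s) T) :
    IsSYT k (N + 1) l (Function.update T (s, l s - 1) N) := by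
  obtain ⟨h1, h2, h3, h4⟩ := hT
  have hc := fun i j => cells_removeBox (l := l) i j hs.1
  have hlt : ∀ i j, j < l i → (i, j) ≠ (s, l s - 1) → T (i, j) < N := fun i j hj hne =>
    h4.mapsTo (show (i, j).2 < removeBox l s (i, j).1 from (hc i j).2 ⟨hj, hne⟩)
  refine ⟨fun i j1 j2 hj hj2 => ?_, fun i1 i2 j hi hj => ?_, fun i j hj => ?_, ?_⟩
  · have hne1 : (i, j1) ≠ (s, l s - 1) := by
      rintro h
      obtain ⟨rfl, rfl⟩ := Prod.mk.inj h
      omega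
    rw [Function.update_of_ne hne1]
    by_cases h : (i, j2) = (s, l s - 1)
    · rw [h, Function.update_self]
      exact hlt i j1 (hj.trans hj2) hne1
    · rw [Function.update_of_ne h]
      exact h1 i j1 j2 hj ((hc i j2).2 ⟨hj2, h⟩)
  · have hne1 : (i1, j) ≠ (s, l s - 1) := by
      rintro h
      obtain ⟨rfl, rfl⟩ := Prod.mk.inj h
      have := hs.2 i2 hi
      omega
    rw [Function.update_of_ne hne1]
    by_cases h : (i2, j) = (s, l s - 1)
    · rw [h, Function.update_self]
      exact hlt i1 j (hj.trans_le (hl hi.le)) hne1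
    · rw [Function.update_of_ne h]
      exact h2 i1 i2 j hi ((hc i2 j).2 ⟨hj, h⟩)
  · rw [Function.update_of_ne]
    · refine h3 i j ?_
      have := hc i j
      omega
    · rintro h
      obtain ⟨rfl, rfl⟩ := Prod.mk.inj h
      have := hs.1
      omega
  · have e1 : {c : Fin k × ℕ | c.2 < l c.1} =
        insert (s, l s - 1) {c | c.2 < removeBox l s c.1} := by
      ext ⟨i, j⟩
      simp only [Set.mem_ofPred_eq, Set.mem_insert_iff, hc i j]
      by_cases h : (i, j) = (s, l s - 1)
      · have := hs.1
        obtain ⟨rfl, rfl⟩ := Prod.mk.inj h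
        simpa
      · simp [h]
    have e2 : Set.Iio (N + 1) = insert (Function.update T (s, l s - 1) N (s, l s - 1))
        (Set.Iio N) := by
      ext
      simp only [Function.update_self, Set.mem_insert_iff, Set.mem_Iio]
      omega
    rw [e1, e2]
    refine (h4.congr fun c hcell => ?_).insert (by simp)
    rw [Function.update_of_ne]
    exact ((hc c.1 c.2).1 hcell).2

lemma IsSYT.exists_corner {T : Fin k × ℕ → ℕ} (hT : IsSYT k (N + 1) l T) :
    ∃ s, IsShapeCorner l s ∧ T (s, l s - 1) = N ∧
      IsSYT k N (removeBox l s) (Function.update T (s, l s - 1) 0) := by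
  obtain ⟨h1, h2, h3, h4⟩ := hT
  obtain ⟨⟨s, j⟩, hsj, hval⟩ := h4.surjOn (Set.mem_Iio.2 N.lt_succ_self)
  simp only [Set.mem_ofPred_eq] at hsj
  have hlt : ∀ i j, j < l i → T (i, j) < N + 1 := fun i j hj =>
    h4.mapsTo (show (i, j).2 < l (i, j).1 from hj)
  have hj : j = l s - 1 := by
    by_contra hne
    have := h1 s j (j + 1) j.lt_succ_self (by omega)
    have := hlt s (j + 1) (by omega)
    omega
  have hs : IsShapeCorner l s := by
    refine ⟨by omega, fun i hi => ?_⟩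
    by_contra hle
    have := h2 s i j hi (by omega)
    have := hlt i j (by omega)
    omega
  subst hj
  have hc := fun i j => cells_removeBox (l := l) i j hs.1
  have hu : ∀ i j, j < removeBox l s i → Function.update T (s, l s - 1) 0 (i, j) = T (i, j) :=
    fun i j hj => Function.update_of_ne ((hc i j).1 hj).2 _ _
  refine ⟨s, hs, hval, fun i j1 j2 hj hj2 => ?_, fun i1 i2 j hi hj => ?_, fun i j hj => ?_, ?_⟩
  · rw [hu i j1 (hj.trans hj2), hu i j2 hj2]
    exact h1 i j1 j2 hj ((hc i j2).1 hj2).1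
  · have hlt2 := ((hc i2 j).1 hj).1
    have := h2 i1 i2 j hi hlt2
    rw [hu i2 j hj, Function.update_of_ne]
    · exact this
    · rintro h
      obtain ⟨rfl, rfl⟩ := Prod.mk.inj h
      have := hs.2 i2 hi
      omega
  · by_cases h : (i, j) = (s, l s - 1)
    · rw [h, Function.update_self]
    · rw [Function.update_of_ne h]
      refine h3 i j ?_
      have := hc i j
      by_contra hlt
      have := this.2 ⟨by omega, h⟩
      omega
  · have e1 : {c : Fin k × ℕ | c.2 < removeBox l s c.1} =
        {c | c.2 < l c.1} \ {(s, l s - 1)} := by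
      ext ⟨i, j⟩
      simp only [Set.mem_ofPred_eq, Set.mem_sdiff, Set.mem_singleton_iff]
      exact hc i j
    have e2 : Set.Iio N = Set.Iio (N + 1) \ {T (s, l s - 1)} := by
      ext
      simp only [hval, Set.mem_sdiff, Set.mem_singleton_iff, Set.mem_Iio]
      omega
    have := h4.sdiff_singleton
      (show (s, l s - 1) ∈ {c : Fin k × ℕ | c.2 < l c.1} from hsj)
    rw [← e1, ← e2] at this
    exact this.congr fun c hcell => (hu c.1 c.2 hcell).symm

lemma sytCount_succ (hl : Antitone l) :
    sytCount k (N + 1) l = ∑ s : {s // IsShapeCorner l s}, sytCount k N (removeBox l s) := by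
  have : ∀ s : {s // IsShapeCorner l s}, Finite {T | IsSYT k N (removeBox l s) T} := fun s =>
    (IsSYT.finite k N _).to_subtype
  simp only [sytCount, ← Nat.card_coe_set_eq]
  rw [← Nat.card_sigma]
  symm
  refine Nat.card_congr (Equiv.ofBijective (fun x => ⟨_, x.2.2.update hl x.1.2⟩) ⟨?_, ?_⟩)
  · rintro ⟨⟨s, hs⟩, T, hT⟩ ⟨⟨s', hs'⟩, T', hT'⟩ heq
    have heq : Function.update T (s, l s - 1) N = Function.update T' (s', l s' - 1) N :=
      congrArg Subtype.val heq
    obtain rfl : s = s' := by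
      have hinj := (hT.update hl hs).2.2.2.injOn
      have h1 : (s, l s - 1).2 < l (s, l s - 1).1 := Nat.sub_lt hs.1 one_pos
      have h2 : (s', l s' - 1).2 < l (s', l s' - 1).1 := Nat.sub_lt hs'.1 one_pos
      refine congrArg Prod.fst (hinj h1 h2 ?_)
      rw [Function.update_self, heq, Function.update_self]
    have : T = T' := by
      funext c
      by_cases hc : c = (s, l s - 1)
      · rw [hc, hT.2.2.1 _ _ (by simp [removeBox]), hT'.2.2.1 _ _ (by simp [removeBox])]
      · have := congrFun heq c
        rwa [Function.update_of_ne hc, Function.update_of_ne hc] at this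
    subst this
    rfl
  · rintro ⟨T, hT⟩
    obtain ⟨s, hs, hval, hT'⟩ := IsSYT.exists_corner hT
    refine ⟨⟨⟨s, hs⟩, _, hT'⟩, Subtype.ext ?_⟩
    simp [← hval]

lemma sytCount_zero (k : ℕ) : sytCount k 0 0 = 1 := by
  rw [sytCount, Set.ncard_eq_one]
  refine ⟨0, Set.ext fun T => ⟨fun hT => ?_, ?_⟩⟩
  · funext c
    exact hT.2.2.1 c.1 c.2 (Nat.zero_le _)
  · rintro rfl
    refine ⟨by simp, by simp, by simp, ?_⟩
    simp

end StandardTableaux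

section Counting

variable {k N : ℕ} {h : ℕ → ℕ → ℕ}

lemma IsPattern.antitone_patternShape (hh : IsPattern k h) : Antitone (patternShape k h) :=
  fun _ _ hij => hh.anti k hij

lemma IsPattern.lt_of_isShapeCorner (hh : IsPattern k h) {s : Fin k}
    (hs : IsShapeCorner (patternShape k h) s) : h k (s + 1) < h k s := by
  by_cases hk : (s : ℕ) + 1 < k
  · exact hs.2 ⟨s + 1, hk⟩ (Fin.lt_def.2 (Nat.lt_succ_self _))
  · rw [hh.eq_zero (not_lt.1 hk)]
    exact hs.1

lemma IsPattern.isShapeCorner_rowInsert (hh : IsPattern k h) {a : ℕ} {s : Fin k}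
    (hs : track h a k = s + 1) : IsShapeCorner (patternShape k (_root_.rowInsert h a)) s := by
  simp only [IsShapeCorner, patternShape, _root_.rowInsert, hs]
  refine ⟨by simp, fun i hi => ?_⟩
  have := hh.anti k hi.le
  have : (s : ℕ) < i := hi
  rw [if_neg (by omega), if_pos trivial]
  omega

/-- Robinson-Schensted-Knuth: the number of words with a given insertion tableau is the number of
standard tableaux of its shape. -/
lemma card_insertionPattern_eq (hh : IsPattern k h) (hN : ∑ i : Fin k, h k i = N) :
    Nat.card {w : Fin N → Fin k // insertionPattern w = h} = sytCount k N (patternShape k h) := by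
  induction N generalizing h with
  | zero =>
    have hshape : ∀ i, h k i = 0 := fun i => by
      rcases lt_or_ge i k with hi | hi
      · exact (Finset.sum_eq_zero_iff.1 hN) ⟨i, hi⟩ (Finset.mem_univ _)
      · exact hh.eq_zero hi
    have hzero : h = fun _ _ => 0 := by
      funext v i
      have := hh.le_top v i
      rw [hshape] at this
      omega
    have hs0 : patternShape k h = 0 := funext fun i => hshape i
    rw [hs0, sytCount_zero, Nat.card_eq_one_iff_unique]
    exact ⟨⟨fun _ _ => Subtype.ext (Subsingleton.elim _ _)⟩, ⟨⟨fun i => i.elim0, hzero.symm⟩⟩⟩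
  | succ N ih =>
    choose g a hg ha ht heq using fun s : {s // IsShapeCorner (patternShape k h) s} =>
      hh.exists_rowInsert_eq (hh.lt_of_isShapeCorner s.2)
    have hval : ∀ s i, h k i = g s k i + if i = (s.1 : ℕ) then 1 else 0 := fun s i => by
      refine (congrFun (congrFun (heq s) k) i).symm.trans ?_
      rw [rowInsert, ht s]
      congr 1
      exact if_congr (by omega) rfl rfl
    have hshape : ∀ s, patternShape k (g s) = removeBox (patternShape k h) s := fun s => by
      funext i
      have := hval s i
      by_cases hi : i = s.1
      · subst hi
        simp only [removeBox, patternShape, Function.update_self]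
        rw [if_pos rfl] at this
        omega
      · rw [if_neg (fun h => hi (Fin.ext h))] at this
        simp only [removeBox, patternShape, Function.update_of_ne hi]
        omega
    have hsum : ∀ s, ∑ i : Fin k, g s k i = N := fun s => by
      have := IsPattern.sum_rowInsert (g s) (a s) (le_refl k)
      rw [heq s, hN, if_pos (ha s)] at this
      omega
    rw [sytCount_succ hh.antitone_patternShape]
    simp only [← hshape]
    rw [← Finset.sum_congr rfl fun s _ => ih (hg s) (hsum s), ← Nat.card_sigma]
    symm
    let f : (Σ s, {w : Fin N → Fin k // insertionPattern w = g s}) →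
        {w : Fin (N + 1) → Fin k // insertionPattern w = h} := fun x =>
      ⟨Fin.snoc x.2.1 ⟨a x.1, ha x.1⟩, by
        simp only [insertionPattern, Fin.init_snoc, Fin.snoc_last, x.2.2, heq]⟩
    refine Nat.card_congr (Equiv.ofBijective f ⟨?_, ?_⟩)
    · rintro ⟨s, w, hw⟩ ⟨s', w', hw'⟩ he
      have he : (Fin.snoc w ⟨a s, ha s⟩ : Fin (N + 1) → Fin k) = Fin.snoc w' ⟨a s', ha s'⟩ :=
        congrArg Subtype.val he
      obtain ⟨rfl, he'⟩ := Fin.snoc_inj.1 he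
      have ht' := ht s
      rw [← hw, hw', Fin.mk.inj he', ht s'] at ht'
      obtain rfl : s = s' := Subtype.ext (Fin.ext (by omega))
      rfl
    · rintro ⟨w, hw⟩
      have hP := isPattern_insertionPattern (Fin.init w)
      have hw' : rowInsert (insertionPattern (Fin.init w)) (w (Fin.last N)) = h := hw
      have h0 := track_eq_zero_iff (insertionPattern (Fin.init w)) (w (Fin.last N)) k
      have h1 := track_le (insertionPattern (Fin.init w)) (w (Fin.last N)) k
      have h2 := (w (Fin.last N)).2
      obtain ⟨s, hs⟩ : ∃ s : Fin k,
          track (insertionPattern (Fin.init w)) (w (Fin.last N)) k = s + 1 :=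
        ⟨⟨track (insertionPattern (Fin.init w)) (w (Fin.last N)) k - 1, by omega⟩, by
          simp only; omega⟩
      have hcor : IsShapeCorner (patternShape k h) s := hw' ▸ hP.isShapeCorner_rowInsert hs
      obtain ⟨hg', ha'⟩ := hP.rowInsert_injective (hg ⟨s, hcor⟩) h2 (ha ⟨s, hcor⟩)
        (hw'.trans (heq ⟨s, hcor⟩).symm) (hs.trans (ht ⟨s, hcor⟩).symm)
      refine ⟨⟨⟨s, hcor⟩, Fin.init w, hg'⟩, Subtype.ext ?_⟩
      change Fin.snoc (Fin.init w) (⟨a ⟨s, hcor⟩, ha ⟨s, hcor⟩⟩ : Fin k) = w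
      rw [show (⟨a ⟨s, hcor⟩, ha ⟨s, hcor⟩⟩ : Fin k) = w (Fin.last N) from Fin.ext ha'.symm]
      exact Fin.snoc_init_self w

end Counting

section SemistandardTableaux

variable {k : ℕ} {l : Fin k → ℕ}

lemma lt_card_filter_range_iff {n : ℕ} {P : ℕ → Prop} [DecidablePred P]
    (hP : ∀ j₁ j₂, j₁ ≤ j₂ → j₂ < n → P j₂ → P j₁) (j : ℕ) :
    j < ((Finset.range n).filter P).card ↔ j < n ∧ P j := by
  induction n with
  | zero => simp
  | succ n ih =>
    rw [Finset.range_add_one, Finset.filter_insert]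
    split_ifs with hn
    · rw [Finset.filter_true_of_mem fun i hi =>
        hP i n (Finset.mem_range.1 hi).le n.lt_succ_self hn]
      simp only [Finset.mem_range, lt_irrefl, not_false_eq_true, Finset.card_insert_of_notMem,
        Finset.card_range]
      exact ⟨fun hj => ⟨hj, hP j n (by omega) n.lt_succ_self hn⟩, fun hj => hj.1⟩
    · rw [ih fun j₁ j₂ h1 h2 => hP j₁ j₂ h1 (h2.trans n.lt_succ_self)]
      refine ⟨fun hj => ⟨by omega, hj.2⟩, fun hj => ⟨?_, hj.2⟩⟩
      have : j ≠ n := by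
        rintro rfl
        exact hn hj.2
      omega

/-- The pattern of a semistandard tableau. -/
def tableauPattern (l : Fin k → ℕ) (T : Fin k × ℕ → ℕ) (v i : ℕ) : ℕ :=
  if hi : i < k then ((Finset.range (l ⟨i, hi⟩)).filter fun j => T (⟨i, hi⟩, j) < v).card else 0

lemma tableauPattern_apply (l : Fin k → ℕ) (T : Fin k × ℕ → ℕ) (v : ℕ) (i : Fin k) :
    tableauPattern l T v i = ((Finset.range (l i)).filter fun j => T (i, j) < v).card := by
  simp [tableauPattern]

lemma IsSSYT.lt_tableauPattern_iff {T : Fin k × ℕ → ℕ} (hT : IsSSYT k l T) (v : ℕ) (i : Fin k)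
    (j : ℕ) : j < tableauPattern l T v i ↔ j < l i ∧ T (i, j) < v := by
  rw [tableauPattern_apply, lt_card_filter_range_iff]
  exact fun j₁ j₂ h1 h2 h3 => (hT.1 i j₁ j₂ h1 h2).trans_lt h3

lemma IsSSYT.finite (k : ℕ) (l : Fin k → ℕ) : {T | IsSSYT k l T}.Finite :=
  (finite_fillings l k).subset fun _ hT => ⟨hT.2.2.1, hT.2.2.2⟩

lemma IsSSYT.isPattern {T : Fin k × ℕ → ℕ} (hl : Antitone l) (hT : IsSSYT k l T) :
    IsPattern k (tableauPattern l T) where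
  zero i := by simp [tableauPattern]
  le_succ v i := by
    by_cases hi : i < k
    · refine le_of_forall_lt fun j hj => ?_
      have := (hT.lt_tableauPattern_iff v ⟨i, hi⟩ j).1 hj
      exact (hT.lt_tableauPattern_iff (v + 1) ⟨i, hi⟩ j).2 ⟨this.1, by omega⟩
    · simp [tableauPattern, hi]
  succ_le v i := by
    by_cases hi : i + 1 < k
    · refine le_of_forall_lt fun j hj => ?_
      have h1 := (hT.lt_tableauPattern_iff (v + 1) ⟨i + 1, hi⟩ j).1 hj
      have hlt : (⟨i, by omega⟩ : Fin k) < ⟨i + 1, hi⟩ := Fin.lt_def.2 i.lt_succ_self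
      have := hT.2.1 _ _ j hlt h1.1
      exact (hT.lt_tableauPattern_iff v ⟨i, by omega⟩ j).2
        ⟨h1.1.trans_le (hl hlt.le), by omega⟩
    · simp [tableauPattern, hi]
  stable v hv i := by
    by_cases hi : i < k
    · simp only [tableauPattern, hi, dif_pos]
      congr 1
      refine Finset.filter_congr fun j hj => ?_
      have := hT.2.2.1 ⟨i, hi⟩ j (Finset.mem_range.1 hj)
      exact iff_of_true (this.trans_le hv) this
    · simp [tableauPattern, hi]

lemma IsSSYT.patternShape_eq {T : Fin k × ℕ → ℕ} (hT : IsSSYT k l T) :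
    patternShape k (tableauPattern l T) = l := by
  funext i
  rw [patternShape, tableauPattern_apply, Finset.filter_true_of_mem, Finset.card_range]
  exact fun j hj => hT.2.2.1 i j (Finset.mem_range.1 hj)

lemma exists_forall_lt_iff {P : ℕ → Prop} (h0 : ¬P 0) (hmono : ∀ v, P v → P (v + 1))
    (hex : ∃ v, P v) : ∃ u, ∀ v, u < v ↔ P v := by
  have hmono' : ∀ v w, v ≤ w → P v → P w := fun v w hvw hv => by
    induction w, hvw using Nat.le_induction with
    | base => exact hv
    | succ w _ ih => exact hmono w ih
  have hpos : Nat.find hex ≠ 0 := fun h => h0 (h ▸ Nat.find_spec hex)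
  refine ⟨Nat.find hex - 1, fun v => ⟨fun hv => hmono' _ v (by omega) (Nat.find_spec hex),
    fun hv => ?_⟩⟩
  have := Nat.find_min' hex hv
  omega

/-- Semistandard tableaux of shape `l` correspond to patterns of shape `l`. -/
lemma bijOn_tableauPattern (hl : Antitone l) :
    Set.BijOn (tableauPattern l) {T | IsSSYT k l T}
      {g | IsPattern k g ∧ patternShape k g = l} := by
  refine ⟨fun T hT => ⟨IsSSYT.isPattern hl hT, IsSSYT.patternShape_eq hT⟩,
    fun T hT T' hT' heq => ?_, ?_⟩
  · funext ⟨i, j⟩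
    by_cases hj : j < l i
    · refine eq_of_forall_gt_iff fun v => ?_
      have h1 := IsSSYT.lt_tableauPattern_iff hT v i j
      have h2 := IsSSYT.lt_tableauPattern_iff hT' v i j
      rw [heq] at h1
      have := h1.symm.trans h2
      simpa [hj] using this
    · rw [hT.2.2.2 i j (not_lt.1 hj), hT'.2.2.2 i j (not_lt.1 hj)]
  · rintro g ⟨hg, rfl⟩
    have hex : ∀ c : Fin k × ℕ, ∃ u, (c.2 < g k c.1 → ∀ v, u < v ↔ c.2 < g v c.1) ∧
        (g k c.1 ≤ c.2 → u = 0) := by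
      rintro ⟨i, j⟩
      by_cases hj : j < g k i
      · obtain ⟨u, hu⟩ := exists_forall_lt_iff (P := fun v => j < g v i) (by simp [hg.zero])
          (fun v hv => hv.trans_le (hg.le_succ v i)) ⟨k, hj⟩
        exact ⟨u, fun _ => hu, fun h => absurd hj (not_lt.2 h)⟩
      · exact ⟨0, fun h => absurd h hj, fun _ => rfl⟩
    choose T hT hT0 using hex
    have key : ∀ (i : Fin k) (j : ℕ), j < g k i → ∀ v, T (i, j) < v ↔ j < g v i :=
      fun i j => hT (i, j)
    have hS : IsSSYT k (patternShape k g) T := by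
      refine ⟨fun i j₁ j₂ hj hj₂ => ?_, fun i₁ i₂ j hi hj => ?_, fun i j hj => ?_,
        fun i j hj => hT0 (i, j) hj⟩
      · have := (key i j₂ hj₂ _).1 (Nat.lt_succ_self _)
        exact Nat.lt_succ_iff.1 ((key i j₁ (hj.trans_lt hj₂) _).2 (hj.trans_lt this))
      · have h1 := (key i₂ j hj _).1 (Nat.lt_succ_self _)
        have h2 := hg.anti (T (i₂, j) + 1) (show (i₁ : ℕ) + 1 ≤ i₂ from hi)
        exact (key i₁ j (hj.trans_le (hg.anti k hi.le)) _).2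
          (h1.trans_le (h2.trans (hg.succ_le _ _)))
      · exact (key i j hj k).2 hj
    refine ⟨T, hS, ?_⟩
    funext v i
    by_cases hi : i < k
    · refine eq_of_forall_lt_iff fun j => ?_
      refine (hS.lt_tableauPattern_iff v ⟨i, hi⟩ j).trans
        ⟨fun hj => (key ⟨i, hi⟩ j hj.1 v).1 hj.2, fun hj => ?_⟩
      have hjk : j < g k i := hj.trans_le (hg.le_top v i)
      exact ⟨hjk, (key ⟨i, hi⟩ j hjk v).2 hj⟩
    · simp [tableauPattern, hi, hg.eq_zero_of_le (not_lt.1 hi)]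

lemma patternWeight_tableauPattern (p : Fin k → ℝ) (l : Fin k → ℕ) (T : Fin k × ℕ → ℕ) :
    patternWeight k p (tableauPattern l T) =
      ∏ v : Fin k, p v ^ ({c : Fin k × ℕ | c.2 < l c.1 ∧ T c = (v : ℕ)}.ncard) := by
  refine Finset.prod_congr rfl fun v _ => ?_
  congr 1
  have hset : {c : Fin k × ℕ | c.2 < l c.1 ∧ T c = (v : ℕ)} =
      ((Finset.univ.sigma fun i => (Finset.range (l i)).filter fun j => T (i, j) = v).map
        (Equiv.sigmaEquivProd (Fin k) ℕ).toEmbedding : Finset (Fin k × ℕ)) := by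
    ext ⟨i, j⟩
    simp
  rw [hset, Set.ncard_coe_finset, Finset.card_map, Finset.card_sigma]
  refine Finset.sum_congr rfl fun i _ => ?_
  rw [tableauPattern_apply, tableauPattern_apply]
  refine Nat.sub_eq_of_eq_add ?_
  simp only [Finset.card_filter]
  rw [← Finset.sum_add_distrib]
  refine Finset.sum_congr rfl fun j _ => ?_
  split_ifs <;> omega

lemma schur_eq_finsum_patternWeight (hl : Antitone l) (p : Fin k → ℝ) :
    schur k l p = ∑ᶠ g ∈ {g | IsPattern k g ∧ patternShape k g = l}, patternWeight k p g :=
  finsum_mem_eq_of_bijOn _ (bijOn_tableauPattern hl)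
    fun T _ => (patternWeight_tableauPattern p l T).symm

end SemistandardTableaux

lemma schur_mul_sytCount {k N : ℕ} {l : Fin k → ℕ} (hl : Antitone l) (hN : ∑ i, l i = N)
    (p : Fin k → ℝ) :
    schur k l p * (sytCount k N l : ℝ) =
      ∑ w : Fin N → Fin k with patternShape k (insertionPattern w) = l, ∏ i, p (w i) := by
  have hfin : {g | IsPattern k g ∧ patternShape k g = l}.Finite :=
    (bijOn_tableauPattern hl).image_eq ▸ (IsSSYT.finite k l).image _
  rw [schur_eq_finsum_patternWeight hl, finsum_mem_eq_finite_toFinset_sum _ hfin, Finset.sum_mul]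
  rw [← Finset.sum_fiberwise_of_maps_to (g := insertionPattern) (t := hfin.toFinset)
    fun w hw => hfin.mem_toFinset.2
      ⟨isPattern_insertionPattern w, (Finset.mem_filter.1 hw).2⟩]
  refine Finset.sum_congr rfl fun g hg => ?_
  obtain ⟨hg, hgl⟩ := hfin.mem_toFinset.1 hg
  have hcard := card_insertionPattern_eq (N := N) hg (by rw [← hN, ← hgl]; rfl)
  rw [Nat.card_eq_fintype_card, Fintype.card_subtype, hgl] at hcard
  rw [Finset.filter_filter, ← hcard, mul_comm, ← nsmul_eq_mul, ← Finset.sum_const]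
  refine Finset.sum_congr ?_ fun w hw => ?_
  · ext w
    simp only [Finset.mem_filter, Finset.mem_univ, true_and]
    exact ⟨fun h => ⟨by rw [h, hgl], h⟩, fun h => h.2⟩
  · rw [← patternWeight_insertionPattern, (Finset.mem_filter.1 hw).2.2]

/-- For `n ≥ 1` and any `N`, the probability that the longest weakly
increasing subsequence of an inhomogeneous random word of length `N` has length at most `n`
equals `Σ_{λ ⊢ N, ℓ(λ) ≤ k, λ₁ ≤ n} s_λ(p) f^λ`. -/
theorem random_words_prob_eq_schur_sum
    (k : ℕ) (hk : 0 < k) (p : Fin k → ℝ)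
    (hp : ∀ i, 0 < p i ∧ p i < 1) (hsum : ∑ i, p i = 1)
    (n N : ℕ) (hn : 1 ≤ n) :
    wordProb k N p {w | lisLen w ≤ n} =
      ∑ᶠ l ∈ {l : Fin k → ℕ | Antitone l ∧ (∑ i, l i = N) ∧ l ⟨0, hk⟩ ≤ n},
        schur k l p * (sytCount k N l : ℝ) := by
  have hA : {l : Fin k → ℕ | Antitone l ∧ (∑ i, l i = N) ∧ l ⟨0, hk⟩ ≤ n}.Finite :=
    (Set.finite_Iic fun _ : Fin k => N).subset fun l hl i =>
      hl.2.1 ▸ Finset.single_le_sum (fun _ _ => Nat.zero_le _) (Finset.mem_univ i)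
  rw [finsum_mem_eq_finite_toFinset_sum _ hA, wordProb, Finset.sum_indicator_eq_sum_filter]
  rw [← Finset.sum_fiberwise_of_maps_to (t := hA.toFinset)
    (g := fun w : Fin N → Fin k => patternShape k (insertionPattern w))]
  · refine Finset.sum_congr rfl fun l hl => ?_
    obtain ⟨hanti, hN, hl0⟩ := hA.mem_toFinset.1 hl
    rw [schur_mul_sytCount hanti hN, Finset.filter_filter]
    refine Finset.sum_congr ?_ fun _ _ => rfl
    ext w
    simp only [Finset.mem_filter, Finset.mem_univ, true_and, Set.mem_ofPred_eq]
    refine ⟨fun h => h.2, fun h => ⟨?_, h⟩⟩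
    rw [lisLen_eq]
    exact (congrFun h ⟨0, hk⟩).le.trans hl0
  · intro w hw
    have hw : lisLen w ≤ n := (Finset.mem_filter.1 hw).2
    rw [lisLen_eq] at hw
    exact hA.mem_toFinset.2 ⟨(isPattern_insertionPattern w).antitone_patternShape,
      sum_insertionPattern w, hw⟩

end
end

section
/- For every n ≥ 1 and every real t, the exponential generating function Σ_{N=0}^∞ Prob(ℓ_N ≤ n) t^N/N! converges and equals the n×n Toeplitz determinant det(c_{i−j})_{i,j=1}^n, where c_m = (1/2π)∫₀^{2π} exp(t e^{−iθ}) ∏_{j=1}^k (1 + p_j e^{iθ}) e^{−imθ} dθ is the m-th Fourier coefficient of the function f_I(e^{iθ}) = e^{t e^{−iθ}} ∏_{j=1}^k (1 + p_j e^{iθ}) on the unit circle. -/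
open MeasureTheory Filter
open scoped Classical

noncomputable section

/-- Length of the longest weakly increasing subsequence of `w` with all letters at least `b`. -/
def lisLenFrom {k N : ℕ} (b : ℕ) (w : Fin N → Fin k) : ℕ :=
  (Finset.univ.filter fun s : Finset (Fin N) =>
    (∀ i ∈ s, b ≤ (w i : ℕ)) ∧ ∀ i ∈ s, ∀ j ∈ s, i ≤ j → w i ≤ w j).sup Finset.card

lemma lisLenFrom_le_iff {k N : ℕ} {b m : ℕ} {w : Fin N → Fin k} :
    lisLenFrom b w ≤ m ↔ ∀ s : Finset (Fin N),
      (∀ i ∈ s, b ≤ (w i : ℕ)) → (∀ i ∈ s, ∀ j ∈ s, i ≤ j → w i ≤ w j) → s.card ≤ m := by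
  simp [lisLenFrom, Finset.sup_le_iff]

lemma lisLenFrom_zero {k N : ℕ} (w : Fin N → Fin k) : lisLenFrom 0 w = lisLen w := by
  simp [lisLenFrom, lisLen]

lemma lisLenFrom_empty {k : ℕ} (b : ℕ) (w : Fin 0 → Fin k) : lisLenFrom b w = 0 := by
  rw [← Nat.le_zero, lisLenFrom_le_iff]
  intro s _ _
  simp [Finset.eq_empty_of_isEmpty s]

lemma lisLenFrom_top {k N : ℕ} (w : Fin N → Fin k) : lisLenFrom k w = 0 := by
  rw [← Nat.le_zero, lisLenFrom_le_iff]
  intro s hs _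
  have : s = ∅ := Finset.eq_empty_of_forall_notMem fun i hi => absurd (hs i hi) (by simp)
  simp [this]

lemma lisLenFrom_anti {k N : ℕ} {b c : ℕ} (h : b ≤ c) (w : Fin N → Fin k) :
    lisLenFrom c w ≤ lisLenFrom b w :=
  lisLenFrom_le_iff.2 fun s hs hw => lisLenFrom_le_iff.1 le_rfl s (fun i hi => h.trans (hs i hi)) hw

lemma lisLenFrom_cons_le_iff {k N : ℕ} {b m : ℕ} (x : Fin k) (w : Fin N → Fin k) :
    lisLenFrom b (Fin.cons x w : Fin (N + 1) → Fin k) ≤ m ↔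
      lisLenFrom b w ≤ m ∧ (b ≤ x → lisLenFrom x w + 1 ≤ m) := by
  constructor
  · intro h
    rw [lisLenFrom_le_iff] at h
    constructor
    · rw [lisLenFrom_le_iff]
      intro s hs hw
      have := h (s.map (Fin.succEmb N)) (by simpa using hs) (by simpa using hw)
      simpa using this
    · intro hb
      rcases m with _ | m
      · have := h {0} (by simpa using hb) (by simp)
        simp at this
      rw [add_le_add_iff_right, lisLenFrom_le_iff]
      intro s hs hw
      have h0 : (0 : Fin (N + 1)) ∉ s.map (Fin.succEmb N) := by simp
      have := h (insert 0 (s.map (Fin.succEmb N)))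
        (by simpa [hb] using fun i hi => hb.trans (hs i hi))
        (by
          simp only [Finset.mem_insert, Finset.mem_map, Fin.coe_succEmb]
          rintro _ (rfl | ⟨i, hi, rfl⟩) _ (rfl | ⟨j, hj, rfl⟩) hij
          · simp
          · simpa using hs j hj
          · simp at hij
          · simpa using hw i hi j hj (by simpa using hij))
      rw [Finset.card_insert_of_notMem h0, Finset.card_map] at this
      omega
  · rintro ⟨h1, h2⟩
    rw [lisLenFrom_le_iff]
    intro s hs hw
    set s' : Finset (Fin N) := Finset.univ.filter fun i => i.succ ∈ s with hs'
    have hw' : ∀ i ∈ s', ∀ j ∈ s', i ≤ j → w i ≤ w j := by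
      intro i hi j hj hij
      simpa using hw i.succ (by simpa [hs'] using hi) j.succ (by simpa [hs'] using hj)
        (by simpa using hij)
    by_cases h0 : (0 : Fin (N + 1)) ∈ s
    · have hcard : s.card = s'.card + 1 := by
        have : s = insert 0 (s'.map (Fin.succEmb N)) := by
          ext i
          refine Fin.cases ?_ (fun i => ?_) i <;> simp [h0, hs']
        rw [this, Finset.card_insert_of_notMem (by simp), Finset.card_map]
      have hb : b ≤ (x : ℕ) := by simpa using hs 0 h0
      have := lisLenFrom_le_iff.1 (le_refl (lisLenFrom x w)) s' (fun i hi => by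
        simpa using hw 0 h0 i.succ (by simpa [hs'] using hi) (by simp)) hw'
      have := h2 hb
      omega
    · have hcard : s.card = s'.card := by
        have : s = s'.map (Fin.succEmb N) := by
          ext i
          refine Fin.cases ?_ (fun i => ?_) i <;> simp [h0, hs']
        conv_lhs => rw [this]
        rw [Finset.card_map]
      rw [hcard]
      exact lisLenFrom_le_iff.1 h1 s' (fun i hi => by
        simpa using hs i.succ (by simpa [hs'] using hi)) hw'

/-- Appending the word `w` to a word whose patience sorting piles show `y 1 ≤ ⋯ ≤ y n` (an empty
pile showing a letter larger than all others) creates no `(n + 1)`-st pile. -/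
def FitsPiles {k N : ℕ} (n : ℕ) (y : ℕ → ℕ) (w : Fin N → Fin k) : Prop :=
  ∀ i ≤ n, lisLenFrom (y i) w + i ≤ n

lemma fitsPiles_cons_iff {k N n i : ℕ} {y : ℕ → ℕ} (hy : Monotone y) {x : Fin k}
    (hi : i < n) (h1 : y i ≤ x) (h2 : x < y (i + 1)) (w : Fin N → Fin k) :
    FitsPiles n y (Fin.cons x w : Fin (N + 1) → Fin k) ↔
      FitsPiles n (Function.update y (i + 1) x) w := by
  have key : FitsPiles n y (Fin.cons x w : Fin (N + 1) → Fin k) ↔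
      ∀ j ≤ n, lisLenFrom (y j) w + j ≤ n ∧ (y j ≤ x → lisLenFrom x w + 1 + j ≤ n) := by
    refine forall₂_congr fun j hj => ?_
    rw [← Nat.le_sub_iff_add_le hj, lisLenFrom_cons_le_iff, Nat.le_sub_iff_add_le hj,
      Nat.le_sub_iff_add_le hj]
  rw [key]
  constructor
  · intro h j hj
    rcases eq_or_ne j (i + 1) with rfl | hne
    · have := (h i hi.le).2 h1
      simp only [Function.update_self]
      omega
    · simpa [Function.update_of_ne hne] using (h j hj).1
  · intro h j hj
    have hx : lisLenFrom x w + (i + 1) ≤ n := by simpa using h (i + 1) hi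
    refine ⟨?_, fun hjx => ?_⟩
    · rcases eq_or_ne j (i + 1) with rfl | hne
      · have := lisLenFrom_anti h2.le w
        omega
      · simpa [Function.update_of_ne hne] using h j hj
    · have : j ≤ i := by
        by_contra! hc
        have := hy (show i + 1 ≤ j from hc)
        omega
      omega

lemma not_fitsPiles_cons {k N n : ℕ} {y : ℕ → ℕ} {x : Fin k} (h : y n ≤ x) (w : Fin N → Fin k) :
    ¬ FitsPiles n y (Fin.cons x w : Fin (N + 1) → Fin k) := by
  intro hf
  have : lisLenFrom (y n) (Fin.cons x w : Fin (N + 1) → Fin k) ≤ 0 := by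
    have := hf n le_rfl
    omega
  have := ((lisLenFrom_cons_le_iff x w).1 this).2 h
  omega

lemma monotone_update_succ {y : ℕ → ℕ} (hy : Monotone y) {i x : ℕ} (h1 : y i ≤ x)
    (h2 : x < y (i + 1)) : Monotone (Function.update y (i + 1) x) := by
  intro a b hab
  simp only [Function.update_apply]
  split_ifs with ha hb hb
  · rfl
  · exact h2.le.trans (hy (by omega))
  · exact (hy (by omega)).trans h1
  · exact hy hab

/-- The total weight of the words of length `N` satisfying `FitsPiles n y`. -/
def fitsWeight (k : ℕ) (p : ℕ → ℂ) (n N : ℕ) (y : ℕ → ℕ) : ℂ :=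
  ∑ w : Fin N → Fin k, if FitsPiles n y w then ∏ i, p (w i) else 0

lemma fitsWeight_zero (k : ℕ) (p : ℕ → ℂ) (n : ℕ) (y : ℕ → ℕ) : fitsWeight k p n 0 y = 1 := by
  have : ∀ w : Fin 0 → Fin k, FitsPiles n y w := fun w i hi => by simpa [lisLenFrom_empty] using hi
  simp [fitsWeight, this]

lemma exists_mem_Ico_succ {n x : ℕ} {y : ℕ → ℕ} (h0 : y 0 = 0) (hx : x < y n) :
    ∃ i < n, y i ≤ x ∧ x < y (i + 1) := by
  induction n with
  | zero => omega
  | succ n ih =>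
    by_cases h : x < y n
    · obtain ⟨i, hi, h'⟩ := ih h
      exact ⟨i, by omega, h'⟩
    · exact ⟨n, by omega, by omega, hx⟩

lemma fitsWeight_succ {k : ℕ} (p : ℕ → ℂ) (n N : ℕ) {y : ℕ → ℕ} (hy : Monotone y)
    (h0 : y 0 = 0) (hk : ∀ i, y i ≤ k) :
    fitsWeight k p n (N + 1) y = ∑ i ∈ Finset.range n, ∑ x ∈ Finset.Ico (y i) (y (i + 1)),
      p x * fitsWeight k p n N (Function.update y (i + 1) x) := by
  have step : ∀ x : Fin k, (∑ w : Fin N → Fin k,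
      if FitsPiles n y (Fin.cons x w : Fin (N + 1) → Fin k) then ∏ i, p (w i) else 0) =
      ∑ i ∈ Finset.range n, if y i ≤ x ∧ (x : ℕ) < y (i + 1) then
        fitsWeight k p n N (Function.update y (i + 1) x) else 0 := by
    intro x
    by_cases hx : (x : ℕ) < y n
    · obtain ⟨i, hi, h1, h2⟩ := exists_mem_Ico_succ h0 hx
      rw [Finset.sum_eq_single_of_mem i (Finset.mem_range.2 hi), if_pos ⟨h1, h2⟩, fitsWeight]
      · simp only [fitsPiles_cons_iff hy hi h1 h2]
      · intro j _ hj
        refine if_neg fun h => ?_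
        rcases lt_or_gt_of_ne hj with hlt | hlt
        · have := hy (show j + 1 ≤ i from hlt)
          omega
        · have := hy (show i + 1 ≤ j from hlt)
          omega
    · rw [Finset.sum_eq_zero, Finset.sum_eq_zero]
      · intro i hi
        have := hy (show i + 1 ≤ n from Finset.mem_range.1 hi)
        exact if_neg (by omega)
      · intro w _
        exact if_neg (not_fitsPiles_cons (by omega) w)
  have hcons : fitsWeight k p n (N + 1) y = ∑ x : Fin k, p x * ∑ w : Fin N → Fin k,
      if FitsPiles n y (Fin.cons x w : Fin (N + 1) → Fin k) then ∏ i, p (w i) else 0 := by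
    rw [fitsWeight, ← (Fin.consEquiv fun _ : Fin (N + 1) => Fin k).sum_comp, Fintype.sum_prod_type]
    refine Finset.sum_congr rfl fun x _ => ?_
    rw [Finset.mul_sum]
    refine Finset.sum_congr rfl fun w _ => ?_
    simp [Fin.consEquiv, Fin.prod_univ_succ]
  rw [hcons]
  simp_rw [step, Finset.mul_sum]
  rw [Finset.sum_comm]
  refine Finset.sum_congr rfl fun i _ => ?_
  have hIco : Finset.Ico (y i) (y (i + 1)) =
      (Finset.range k).filter fun x => y i ≤ x ∧ x < y (i + 1) := by
    ext x
    have := hk (i + 1)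
    simp only [Finset.mem_Ico, Finset.mem_filter, Finset.mem_range]
    omega
  rw [hIco, Finset.sum_filter, ← Fin.sum_univ_eq_sum_range (fun x => if y i ≤ x ∧ x < y (i + 1) then
    p x * fitsWeight k p n N (Function.update y (i + 1) x) else 0)]
  simp

open Polynomial in
/-- As a polynomial in `t`, the coefficient of `z ^ m` in `exp (t / z) * ∏ x < y, (1 + p x * z)`. -/
def symbolCoeff (p : ℕ → ℂ) : ℕ → ℤ → ℂ[X]
  | 0, m => if m ≤ 0 then C (1 / ((-m).toNat.factorial : ℂ)) * X ^ (-m).toNat else 0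
  | y + 1, m => symbolCoeff p y m + C (p y) * symbolCoeff p y (m - 1)

section SymbolCoeff
open Polynomial

variable (p : ℕ → ℂ)

lemma symbolCoeff_zero_of_pos {m : ℤ} (hm : 0 < m) : symbolCoeff p 0 m = 0 := by
  simp [symbolCoeff, hm]

lemma derivative_symbolCoeff (y : ℕ) (m : ℤ) :
    derivative (symbolCoeff p y m) = symbolCoeff p y (m + 1) := by
  induction y generalizing m with
  | zero =>
    rcases lt_trichotomy m 0 with h | rfl | h
    · obtain ⟨b, rfl⟩ : ∃ b : ℕ, m = -(b + 1 : ℤ) := ⟨(-m).toNat - 1, by omega⟩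
      have h1 : (-(-(b + 1 : ℤ))).toNat = b + 1 := by omega
      have h2 : (-(-(b + 1 : ℤ) + 1)).toNat = b := by omega
      have hb : (b.factorial : ℂ) ≠ 0 := by exact_mod_cast b.factorial_ne_zero
      have hb' : (b + 1 : ℂ) ≠ 0 := by exact_mod_cast b.succ_ne_zero
      rw [symbolCoeff, symbolCoeff, if_pos (by omega), if_pos (by omega), h1, h2,
        derivative_C_mul_X_pow, Nat.factorial_succ]
      simp only [Nat.add_sub_cancel]
      congr 2
      push_cast
      field_simp
    · simp [symbolCoeff]
    · rw [symbolCoeff_zero_of_pos p h, symbolCoeff_zero_of_pos p (by omega), derivative_zero]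
  | succ y ih =>
    simp only [symbolCoeff, derivative_add, derivative_C_mul, ih]
    ring_nf

lemma sum_Ico_symbolCoeff {a b : ℕ} (hab : a ≤ b) (m : ℤ) :
    ∑ x ∈ Finset.Ico a b, C (p x) * symbolCoeff p x m =
      symbolCoeff p b (m + 1) - symbolCoeff p a (m + 1) := by
  induction b, hab using Nat.le_induction with
  | base => simp
  | succ b hab ih =>
    rw [Finset.sum_Ico_succ_top hab, ih, symbolCoeff]
    ring_nf

lemma coeff_zero_symbolCoeff_neg (y : ℕ) {m : ℤ} (hm : m < 0) :
    (symbolCoeff p y m).coeff 0 = 0 := by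
  induction y generalizing m with
  | zero =>
    have : (-m).toNat ≠ 0 := by omega
    simp [symbolCoeff, hm.le, coeff_X_pow, this.symm]
  | succ y ih => simp [symbolCoeff, ih hm, ih (show m - 1 < 0 by omega)]

lemma coeff_zero_symbolCoeff_zero (y : ℕ) : (symbolCoeff p y 0).coeff 0 = 1 := by
  induction y with
  | zero => simp [symbolCoeff]
  | succ y ih => simp [symbolCoeff, ih, coeff_zero_symbolCoeff_neg p y (show (-1 : ℤ) < 0 by simp)]

/-- The derivative of a determinant, expanded along the rows. -/
lemma derivative_det_eq_sum_updateRow {R ι : Type*} [CommRing R] [Fintype ι]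
    [DecidableEq ι] (M : Matrix ι ι R[X]) :
    derivative M.det = ∑ i, (M.updateRow i fun j => derivative (M i j)).det := by
  rw [← Matrix.det_transpose]
  simp_rw [← Matrix.det_transpose (M.updateRow _ _), Matrix.det_apply]
  rw [derivative_sum, Finset.sum_comm]
  refine Finset.sum_congr rfl fun σ _ => ?_
  rw [← Finset.smul_sum, Units.smul_def, Units.smul_def, derivative_smul,
    derivative_prod_finset]
  congr 1
  refine Finset.sum_congr rfl fun i _ => ?_
  rw [← Finset.prod_erase_mul _ _ (Finset.mem_univ i)]
  simp only [Matrix.transpose_apply, Matrix.updateRow_self]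
  congr 1
  refine Finset.prod_congr rfl fun j hj => ?_
  rw [Matrix.updateRow_ne (Finset.ne_of_mem_erase hj)]

/-- The matrix of coefficients attached to the pile tops `y 1, …, y n`. -/
def pileMatrix (n : ℕ) (y : ℕ → ℕ) : Matrix (Fin n) (Fin n) ℂ[X] :=
  Matrix.of fun i j => symbolCoeff p (y (i + 1)) ((j : ℤ) - i)

lemma coeff_zero_det_pileMatrix (n : ℕ) (y : ℕ → ℕ) : (pileMatrix p n y).det.coeff 0 = 1 := by
  rw [← constantCoeff_apply, RingHom.map_det, Matrix.det_of_isUpperTriangular]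
  · simp [pileMatrix, coeff_zero_symbolCoeff_zero]
  · intro i j hij
    have : (j : ℕ) < i := hij
    simpa [pileMatrix] using coeff_zero_symbolCoeff_neg p _ (by omega)

lemma pileMatrix_update (n : ℕ) (y : ℕ → ℕ) (i : Fin n) (x : ℕ) :
    pileMatrix p n (Function.update y (i + 1) x) =
      (pileMatrix p n y).updateRow i fun j => symbolCoeff p x ((j : ℤ) - i) := by
  ext1 a b
  rcases eq_or_ne a i with rfl | h
  · simp [pileMatrix]
  · have : (a : ℕ) ≠ i := fun h' => h (Fin.ext h')
    simp [pileMatrix, Matrix.updateRow_ne h, Function.update_of_ne, this]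

lemma det_updateRow_finset_sum {R ι κ : Type*} [CommRing R] [Fintype ι] [DecidableEq ι]
    (M : Matrix ι ι R) (i : ι) (s : Finset κ) (c : κ → R) (v : κ → ι → R) :
    ∑ x ∈ s, c x * (M.updateRow i (v x)).det = (M.updateRow i (∑ x ∈ s, c x • v x)).det := by
  induction s using Finset.induction_on with
  | empty => exact (Matrix.det_eq_zero_of_row_eq_zero i (by simp)).symm
  | insert x s hx ih =>
    rw [Finset.sum_insert hx, Finset.sum_insert hx, Matrix.det_updateRow_add,
      Matrix.det_updateRow_smul, ih]

lemma det_pileMatrix_updateRow_shift (n : ℕ) {y : ℕ → ℕ} (h0 : y 0 = 0) (i : Fin n) :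
    ((pileMatrix p n y).updateRow i fun j => symbolCoeff p (y i) ((j : ℤ) - i + 1)).det = 0 := by
  rcases Nat.eq_zero_or_pos (i : ℕ) with h | h
  · refine Matrix.det_eq_zero_of_row_eq_zero i fun j => ?_
    rw [Matrix.updateRow_self, h, h0, symbolCoeff_zero_of_pos]
    simp
  · obtain ⟨a, ha⟩ : ∃ a : Fin n, (a : ℕ) + 1 = i :=
      ⟨⟨i - 1, by omega⟩, Nat.sub_add_cancel h⟩
    have hne : a ≠ i := fun h' => by rw [h'] at ha; omega
    refine Matrix.det_zero_of_row_eq hne.symm ?_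
    rw [Matrix.updateRow_self, Matrix.updateRow_ne hne]
    ext1 j
    simp only [pileMatrix, Matrix.of_apply, ha]
    congr 1
    omega

lemma derivative_det_pileMatrix (n : ℕ) {y : ℕ → ℕ} (hy : Monotone y) (h0 : y 0 = 0) :
    derivative (pileMatrix p n y).det =
      ∑ i ∈ Finset.range n, ∑ x ∈ Finset.Ico (y i) (y (i + 1)),
        C (p x) * (pileMatrix p n (Function.update y (i + 1) x)).det := by
  rw [derivative_det_eq_sum_updateRow, ← Fin.sum_univ_eq_sum_range (fun i =>
    ∑ x ∈ Finset.Ico (y i) (y (i + 1)),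
      C (p x) * (pileMatrix p n (Function.update y (i + 1) x)).det)]
  refine Finset.sum_congr rfl fun i _ => ?_
  simp_rw [pileMatrix_update]
  rw [det_updateRow_finset_sum]
  have hrow : (∑ x ∈ Finset.Ico (y i) (y (i + 1)), C (p x) •
      fun j : Fin n => symbolCoeff p x ((j : ℤ) - i)) +
      (fun j : Fin n => symbolCoeff p (y i) ((j : ℤ) - i + 1)) =
      fun j => derivative (pileMatrix p n y i j) := by
    ext1 j
    simp only [Pi.add_apply, Finset.sum_apply, Pi.smul_apply, smul_eq_mul, pileMatrix,
      Matrix.of_apply]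
    rw [sum_Ico_symbolCoeff p (hy (Nat.le_succ _)), derivative_symbolCoeff]
    ring
  rw [← hrow, Matrix.det_updateRow_add, det_pileMatrix_updateRow_shift p n h0, add_zero]

lemma factorial_mul_coeff_det_pileMatrix (k n N : ℕ) {y : ℕ → ℕ} (hy : Monotone y)
    (h0 : y 0 = 0) (hk : ∀ i, y i ≤ k) :
    (N.factorial : ℂ) * (pileMatrix p n y).det.coeff N = fitsWeight k p n N y := by
  induction N generalizing y with
  | zero => simp [coeff_zero_det_pileMatrix, fitsWeight_zero]
  | succ N ih =>
    have hd := congrArg (fun q => (N.factorial : ℂ) * q.coeff N)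
      (derivative_det_pileMatrix p n hy h0)
    simp only [coeff_derivative, finsetSum_coeff, coeff_C_mul, Finset.mul_sum] at hd
    rw [fitsWeight_succ p n N hy h0 hk, Nat.factorial_succ]
    push_cast
    rw [show ((N : ℂ) + 1) * N.factorial * (pileMatrix p n y).det.coeff (N + 1) =
      N.factorial * ((pileMatrix p n y).det.coeff (N + 1) * (N + 1)) by ring, hd]
    refine Finset.sum_congr rfl fun i _ => Finset.sum_congr rfl fun x hx => ?_
    rw [Finset.mem_Ico] at hx
    rw [mul_left_comm, ih (monotone_update_succ hy hx.1 hx.2)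
      (by rw [Function.update_of_ne (by omega), h0])]
    intro j
    rw [Function.update_apply]
    split_ifs
    · exact hx.2.le.trans (hk _)
    · exact hk j

lemma hasSum_det_pileMatrix (k n : ℕ) {y : ℕ → ℕ} (hy : Monotone y) (h0 : y 0 = 0)
    (hk : ∀ i, y i ≤ k) (t : ℂ) :
    HasSum (fun N : ℕ => fitsWeight k p n N y * t ^ N / (N.factorial : ℂ))
      ((pileMatrix p n y).det.eval t) := by
  have hterm : ∀ N : ℕ, fitsWeight k p n N y * t ^ N / (N.factorial : ℂ) =
      (pileMatrix p n y).det.coeff N * t ^ N := by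
    intro N
    have : (N.factorial : ℂ) ≠ 0 := by exact_mod_cast N.factorial_ne_zero
    rw [← factorial_mul_coeff_det_pileMatrix p k n N hy h0 hk]
    field_simp
  simp_rw [hterm]
  rw [eval_eq_sum, sum_def]
  exact hasSum_sum_of_ne_finset_zero fun N hN => by simp [notMem_support_iff.1 hN]

end SymbolCoeff

section FourierCoefficient
open Complex

/-- The integrand whose mean over `[0, 2 * π]` is the `m`-th Fourier coefficient of the symbol
`exp (t / z) * ∏ x < y, (1 + p x * z)`. -/
def symbolIntegrand (p : ℕ → ℂ) (t : ℂ) (y : ℕ) (m : ℤ) (θ : ℝ) : ℂ :=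
  exp (t * exp (-(θ : ℂ) * I)) * (∏ x ∈ Finset.range y, (1 + p x * exp ((θ : ℂ) * I))) *
    exp (-(m : ℂ) * (θ : ℂ) * I)

lemma continuous_symbolIntegrand (p : ℕ → ℂ) (t : ℂ) (y : ℕ) (m : ℤ) :
    Continuous (symbolIntegrand p t y m) := by
  unfold symbolIntegrand
  fun_prop

lemma symbolIntegrand_succ (p : ℕ → ℂ) (t : ℂ) (y : ℕ) (m : ℤ) (θ : ℝ) :
    symbolIntegrand p t (y + 1) m θ =
      symbolIntegrand p t y m θ + p y * symbolIntegrand p t y (m - 1) θ := by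
  have : exp (-((m - 1 : ℤ) : ℂ) * (θ : ℂ) * I) =
      exp ((θ : ℂ) * I) * exp (-(m : ℂ) * (θ : ℂ) * I) := by
    rw [← exp_add]
    push_cast
    ring_nf
  simp only [symbolIntegrand, Finset.prod_range_succ, this]
  ring

lemma integral_symbolIntegrand_zero (p : ℕ → ℂ) (t : ℂ) (m : ℤ) :
    ∫ θ in (0 : ℝ)..(2 * Real.pi), symbolIntegrand p t 0 m θ =
      2 * Real.pi * (symbolCoeff p 0 m).eval t := by
  have hflip : ∫ θ in (0 : ℝ)..(2 * Real.pi), symbolIntegrand p t 0 m θ =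
      ∫ θ in (0 : ℝ)..(2 * Real.pi), exp (t * exp ((θ : ℂ) * I)) * exp ((θ : ℂ) * I) ^ m := by
    have := intervalIntegral.integral_comp_sub_left (a := 0) (b := 2 * Real.pi)
      (fun θ => symbolIntegrand p t 0 m θ) (2 * Real.pi)
    rw [sub_self, sub_zero] at this
    rw [← this]
    refine intervalIntegral.integral_congr fun θ _ => ?_
    have h1 : exp (-((2 * Real.pi - θ : ℝ) : ℂ) * I) = exp ((θ : ℂ) * I) := by
      rw [show -((2 * Real.pi - θ : ℝ) : ℂ) * I = (θ : ℂ) * I - 2 * Real.pi * I by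
        push_cast; ring, exp_periodic.sub_eq]
    have h2 : exp (-(m : ℂ) * ((2 * Real.pi - θ : ℝ) : ℂ) * I) = exp ((θ : ℂ) * I) ^ m := by
      rw [← h1, ← exp_int_mul]
      ring_nf
    simp only [symbolIntegrand, h1, h2, Finset.range_zero, Finset.prod_empty, mul_one]
  have hd : Differentiable ℂ fun z : ℂ => exp (t * z) := by fun_prop
  rw [hflip]
  rcases le_or_gt m 0 with hm | hm
  · obtain ⟨b, rfl⟩ : ∃ b : ℕ, m = -(b : ℤ) := ⟨(-m).toNat, by omega⟩
    have hc := (hd.diffContOnCl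
      (s := Metric.ball 0 1)).circleIntegral_one_div_sub_center_pow_smul one_pos b
    rw [circleIntegral, iteratedDeriv_cexp_const_mul] at hc
    have hI : ∀ θ : ℝ, deriv (circleMap 0 1) θ • (1 / (circleMap 0 1 θ - 0) ^ (b + 1)) •
        exp (t * circleMap 0 1 θ) =
        I * (exp (t * exp ((θ : ℂ) * I)) * exp ((θ : ℂ) * I) ^ (-(b : ℤ))) := by
      intro θ
      have := exp_ne_zero ((θ : ℂ) * I)
      simp only [deriv_circleMap, circleMap, ofReal_one, one_mul, zero_add, sub_zero, smul_eq_mul,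
        zpow_neg, zpow_natCast]
      field_simp
      ring
    simp_rw [hI] at hc
    rw [intervalIntegral.integral_const_mul] at hc
    have hcoeff : (symbolCoeff p 0 (-(b : ℤ))).eval t = t ^ b / b.factorial := by
      simp [symbolCoeff, div_eq_inv_mul]
    rw [hcoeff]
    apply mul_left_cancel₀ I_ne_zero
    rw [hc]
    simp
    ring
  · obtain ⟨b, rfl⟩ : ∃ b : ℕ, m = (b : ℤ) + 1 := ⟨(m - 1).toNat, by omega⟩
    have hd' : Differentiable ℂ fun z : ℂ => exp (t * z) * z ^ b := by fun_prop
    have hc := (hd'.diffContOnCl (s := Metric.ball 0 1)).circleIntegral_eq_zero zero_le_one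
    rw [circleIntegral] at hc
    have hI : ∀ θ : ℝ, deriv (circleMap 0 1) θ •
        (exp (t * circleMap 0 1 θ) * circleMap 0 1 θ ^ b) =
        I * (exp (t * exp ((θ : ℂ) * I)) * exp ((θ : ℂ) * I) ^ ((b : ℤ) + 1)) := by
      intro θ
      rw [show ((b : ℤ) + 1) = ((b + 1 : ℕ) : ℤ) by simp, zpow_natCast, pow_succ]
      simp only [deriv_circleMap, circleMap, ofReal_one, one_mul, zero_add, smul_eq_mul]
      ring
    simp_rw [hI] at hc
    rw [intervalIntegral.integral_const_mul] at hc
    rw [symbolCoeff_zero_of_pos p hm, (mul_eq_zero.1 hc).resolve_left I_ne_zero]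
    simp

lemma integral_symbolIntegrand (p : ℕ → ℂ) (t : ℂ) (y : ℕ) (m : ℤ) :
    ∫ θ in (0 : ℝ)..(2 * Real.pi), symbolIntegrand p t y m θ =
      2 * Real.pi * (symbolCoeff p y m).eval t := by
  induction y generalizing m with
  | zero => exact integral_symbolIntegrand_zero p t m
  | succ y ih =>
    simp_rw [symbolIntegrand_succ]
    rw [intervalIntegral.integral_add ((continuous_symbolIntegrand p t y m).intervalIntegrable _ _)
      (((continuous_symbolIntegrand p t y (m - 1)).const_mul _).intervalIntegrable _ _),
      intervalIntegral.integral_const_mul, ih, ih, symbolCoeff]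
    simp
    ring

end FourierCoefficient

lemma fitsPiles_top_iff {k N n : ℕ} (w : Fin N → Fin k) :
    FitsPiles n (fun i => if i = 0 then 0 else k) w ↔ lisLen w ≤ n := by
  rw [← lisLenFrom_zero]
  constructor
  · intro h
    simpa using h 0 (Nat.zero_le n)
  · intro h i hi
    by_cases hi0 : i = 0
    · simpa [hi0] using h
    · simpa [hi0, lisLenFrom_top] using hi

/-- The exponential generating function `Σ_N Prob(ℓ_N ≤ n) t^N/N!`
converges and equals the `n×n` Toeplitz determinant `det(c_{i-j})` of the Fourier
coefficients of `f_I(e^{iθ}) = e^{t e^{-iθ}} ∏_j (1 + p_j e^{iθ})`. -/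
theorem random_words_egf_eq_toeplitz_det
    (k : ℕ) (hk : 0 < k) (p : Fin k → ℝ)
    (hp : ∀ i, 0 < p i ∧ p i < 1) (hsum : ∑ i, p i = 1)
    (n : ℕ) (hn : 1 ≤ n) (t : ℝ) :
    HasSum
      (fun N : ℕ => (wordProb k N p {w | lisLen w ≤ n} : ℂ) * (t : ℂ) ^ N / (N.factorial : ℂ))
      (Matrix.det (Matrix.of fun i j : Fin n =>
        (1 / (2 * (Real.pi : ℂ))) *
          ∫ θ in (0:ℝ)..(2 * Real.pi),
            Complex.exp ((t : ℂ) * Complex.exp (-(θ : ℂ) * Complex.I)) *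
              (∏ m : Fin k, (1 + (p m : ℂ) * Complex.exp ((θ : ℂ) * Complex.I))) *
              Complex.exp (-((((i : ℤ) - (j : ℤ)) : ℤ) : ℂ) * (θ : ℂ) * Complex.I))) := by
  set q : ℕ → ℂ := fun m => if h : m < k then (p ⟨m, h⟩ : ℂ) else 0 with hq
  have hqp : ∀ m : Fin k, q m = p m := fun m => by simp [hq]
  set y : ℕ → ℕ := fun i => if i = 0 then 0 else k with hy
  have hmono : Monotone y := by
    intro a b hab
    simp only [hy]
    split_ifs <;> omega
  have hyk : ∀ i, y i ≤ k := by
    intro i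
    simp only [hy]
    split_ifs <;> omega
  have hmain := hasSum_det_pileMatrix q k n hmono rfl hyk (t : ℂ)
  convert hmain using 1
  · funext N
    congr 2
    simp only [wordProb, fitsWeight, hy, fitsPiles_top_iff, Set.indicator_apply, Set.mem_ofPred_eq]
    push_cast
    refine Finset.sum_congr rfl fun w _ => ?_
    split_ifs <;> simp [hqp]
  · rw [← Polynomial.coe_evalRingHom, RingHom.map_det, ← Matrix.det_transpose]
    congr 1
    ext i j
    have hpi : (Real.pi : ℂ) ≠ 0 := by exact_mod_cast Real.pi_ne_zero
    have hint := integral_symbolIntegrand q t k ((j : ℤ) - i)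
    simp only [symbolIntegrand, ← Fin.prod_univ_eq_prod_range
      (fun x => 1 + q x * Complex.exp (_ * Complex.I)), hqp] at hint
    simp only [Matrix.transpose_apply, Matrix.of_apply, RingHom.mapMatrix_apply, Matrix.map_apply,
      pileMatrix, hy, Polynomial.coe_evalRingHom, Nat.succ_ne_zero, if_false]
    rw [hint]
    field_simp

end
end
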